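/- arXiv:1207.1157 — 4 statements merged into one kernel-verified Lean document; each statement's English description precedes it below -/
import Mathlib

section
/- Let n be a positive integer, let p and q be distinct primes with 2ⁿ < p < 2ⁿ⁺¹ and 2ⁿ < q < 2ⁿ⁺¹, let e₁ = p²q, and let e₂ be a positive integer with gcd(p²q, e₂) = 1. Let C be an integer. If (U₁, V₁) and (U₂, V₂) are pairs of integers with 0 ≤ V₁ < 2^(2n−1), 0 ≤ V₂ < 2^(2n−1), C = U₁·e₁ + V₁²·e₂ and C = U₂·e₁ + V₂²·e₂, then V₁ = V₂ and U₁ = U₂. In other words, the equation C = U·e₁ + V²·e₂ has at most one solution (U, V) with 0 ≤ V < 2^(2n−1). -/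
/-- If `p²q ∣ ab` with `p ≠ q` prime, then one of the factors is divisible by `p²` or `pq`. -/
theorem sq_dvd_or_mul_dvd_of_sq_mul_dvd_mul {p q : ℕ} (hp : p.Prime) (hq : q.Prime)
    (hpq : p ≠ q) {a b : ℤ} (h : (p : ℤ) ^ 2 * q ∣ a * b) :
    ((p : ℤ) ^ 2 ∣ a ∨ (p : ℤ) * q ∣ a) ∨ ((p : ℤ) ^ 2 ∣ b ∨ (p : ℤ) * q ∣ b) := by
  have hp' : Prime (p : ℤ) := Nat.prime_iff_prime_int.mp hp
  have hq' : Prime (q : ℤ) := Nat.prime_iff_prime_int.mp hq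
  have hcop : IsCoprime (p : ℤ) q :=
    Nat.isCoprime_iff_coprime.mpr ((Nat.coprime_primes hp hq).mpr hpq)
  have hsq : (p : ℤ) ^ 2 ∣ a * b := (dvd_mul_right _ _).trans h
  by_cases ha : (p : ℤ) ∣ a
  · by_cases hb : (p : ℤ) ∣ b
    · rcases hq'.dvd_or_dvd ((dvd_mul_left _ _).trans h) with hqa | hqb
      · exact Or.inl (Or.inr (hcop.mul_dvd ha hqa))
      · exact Or.inr (Or.inr (hcop.mul_dvd hb hqb))
    · exact Or.inl (Or.inl (hp'.pow_dvd_of_dvd_mul_right 2 hb hsq))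
  · exact Or.inr (Or.inl (hp'.pow_dvd_of_dvd_mul_left 2 ha hsq))

/-- The AAβ ciphertext equation C = U·e₁ + V²·e₂ with e₁ = p²q has at most one solution
(U, V) with 0 ≤ V < 2^(2n-1). -/
theorem stmt2 (n : ℕ) (hn : 0 < n) (p q : ℕ) (hp : p.Prime) (hq : q.Prime) (hpq : p ≠ q)
    (hp1 : 2 ^ n < p) (hp2 : p < 2 ^ (n + 1)) (hq1 : 2 ^ n < q) (hq2 : q < 2 ^ (n + 1))
    (e₂ : ℤ) (he₂ : 0 < e₂) (hgcd : IsCoprime ((p : ℤ) ^ 2 * q) e₂)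
    (C U₁ V₁ U₂ V₂ : ℤ)
    (hV₁ : 0 ≤ V₁) (hV₁' : V₁ < 2 ^ (2 * n - 1)) (hV₂ : 0 ≤ V₂) (hV₂' : V₂ < 2 ^ (2 * n - 1))
    (h1 : C = U₁ * ((p : ℤ) ^ 2 * q) + V₁ ^ 2 * e₂)
    (h2 : C = U₂ * ((p : ℤ) ^ 2 * q) + V₂ ^ 2 * e₂) :
    V₁ = V₂ ∧ U₁ = U₂ := by
  have hp1' : (2 : ℤ) ^ n < p := by exact_mod_cast hp1
  have hq1' : (2 : ℤ) ^ n < q := by exact_mod_cast hq1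
  have hpos : (0 : ℤ) < 2 ^ n := by positivity
  have hpow : 2 * (2 : ℤ) ^ (2 * n - 1) = 2 ^ n * 2 ^ n := by
    rw [← pow_succ', ← pow_add]
    congr 1
    omega
  have hpp : (2 : ℤ) ^ n * 2 ^ n < (p : ℤ) ^ 2 := by nlinarith
  have hpq' : (2 : ℤ) ^ n * 2 ^ n < (p : ℤ) * q := by nlinarith
  have hdvd : (p : ℤ) ^ 2 * q ∣ (V₁ - V₂) * (V₁ + V₂) :=
    hgcd.dvd_of_dvd_mul_right ⟨U₂ - U₁, by linear_combination h2 - h1⟩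
  have hzero {m x : ℤ} (hm : 2 ^ n * 2 ^ n < m) (hx : |x| < 2 ^ n * 2 ^ n) (h : m ∣ x) : x = 0 :=
    Int.eq_zero_of_abs_lt_dvd h (hx.trans hm)
  have hsub : |V₁ - V₂| < 2 ^ n * 2 ^ n := abs_lt.mpr ⟨by linarith, by linarith⟩
  have hadd : |V₁ + V₂| < 2 ^ n * 2 ^ n := abs_lt.mpr ⟨by linarith, by linarith⟩
  have hV : V₁ = V₂ := by
    rcases sq_dvd_or_mul_dvd_of_sq_mul_dvd_mul hp hq hpq hdvd with (h | h) | (h | h)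
    · linarith [hzero hpp hsub h]
    · linarith [hzero hpq' hsub h]
    · linarith [hzero hpp hadd h]
    · linarith [hzero hpq' hadd h]
  refine ⟨hV, ?_⟩
  subst hV
  have he₁ : (p : ℤ) ^ 2 * q ≠ 0 := by
    have := hp.ne_zero
    have := hq.ne_zero
    positivity
  exact mul_right_cancel₀ he₁ (by linarith)
end

section
/- Let n ≥ 2 be an integer, let p and q be distinct primes with p ≡ q ≡ 3 (mod 4) and 2ⁿ < p, q < 2ⁿ⁺¹, let e₂ and d be integers with gcd(p²q, e₂) = 1 and e₂·d ≡ 1 (mod pq). Let m₁, m₂, k₁, k₂ be integers with 2^(3n) < m₁ < 2^(3n+1), 2^(n−2) < m₂ < 2^(n−1), 2^(n−1) < k₁ < 2ⁿ, 2^(n−1) < k₂ < 2ⁿ, and set U = m₁·2ⁿ + k₁, V = m₂·2ⁿ + k₂, C = U·p²q + V²·e₂. Then V is the unique integer x with 0 ≤ x < 2^(2n−1) satisfying x² ≡ C·d (mod pq) and p²q | (C − x²·e₂); moreover U = (C − V²·e₂)/(p²q), m₁ = ⌊U/2ⁿ⌋ and m₂ = ⌊V/2ⁿ⌋. In particular AAβ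 decryption recovers the plaintext uniquely and there is no decryption failure. -/
open Int

/-- If `p ^ 2 * q` divides `a ^ 2 - b ^ 2` and `a + b` is positive and smaller than both `p ^ 2`
and `p * q`, with `a` and `b` nonnegative, then `a = b`. -/
theorem eq_of_sq_mul_dvd_sq_sub_sq {p q a b : ℤ} (hp : Prime p) (hq : Prime q)
    (hcop : IsCoprime p q) (ha : 0 ≤ a) (hb : 0 ≤ b) (hpos : 0 < a + b)
    (hpp : a + b < p ^ 2) (hpq : a + b < p * q) (h : p ^ 2 * q ∣ a ^ 2 - b ^ 2) : a = b := by
  have hfac : a ^ 2 - b ^ 2 = (a - b) * (a + b) := by ring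
  rw [hfac] at h
  have sub_case : ∀ m : ℤ, a + b < m → m ∣ a - b → a = b := fun m hm hdvd =>
    sub_eq_zero.mp (Int.eq_zero_of_abs_lt_dvd hdvd (abs_lt.mpr ⟨by linarith, by linarith⟩))
  have add_case : ∀ m : ℤ, a + b < m → ¬ m ∣ a + b := fun m hm hdvd =>
    absurd (Int.le_of_dvd hpos hdvd) (not_le.mpr hm)
  have hp2 : p ^ 2 ∣ (a - b) * (a + b) := (dvd_mul_right _ _).trans h
  have hq1 : q ∣ (a - b) * (a + b) := (dvd_mul_left _ _).trans h
  by_cases h1 : p ∣ a - b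
  · by_cases h2 : p ∣ a + b
    · rcases hq.dvd_or_dvd hq1 with h3 | h3
      · exact sub_case _ hpq (hcop.mul_dvd h1 h3)
      · exact absurd (hcop.mul_dvd h2 h3) (add_case _ hpq)
    · exact sub_case _ hpp (hp.pow_dvd_of_dvd_mul_right 2 h2 hp2)
  · exact absurd (hp.pow_dvd_of_dvd_mul_left 2 h1 hp2) (add_case _ hpp)

/-- A quotient digit is recovered by floor division. -/
theorem eq_mul_add_ediv {m b k : ℤ} (hk : 0 ≤ k) (hkb : k < b) : m = (m * b + k) / b := by
  rw [add_comm, Int.add_mul_ediv_right _ _ (by linarith), Int.ediv_eq_zero_of_lt hk hkb, zero_add]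

/-- AAβ decryption recovers the plaintext uniquely: V is the unique x ∈ [0, 2^(2n-1))
with x² ≡ C·d (mod pq) and p²q ∣ (C − x²·e₂); moreover U = (C − V²·e₂)/(p²q),
m₁ = ⌊U/2ⁿ⌋ and m₂ = ⌊V/2ⁿ⌋. -/
theorem stmt4 (n : ℕ) (hn : 2 ≤ n) (p q : ℕ) (hp : p.Prime) (hq : q.Prime) (hpq : p ≠ q)
    (hp4 : p % 4 = 3) (hq4 : q % 4 = 3)
    (hp1 : 2 ^ n < p) (hp2 : p < 2 ^ (n + 1)) (hq1 : 2 ^ n < q) (hq2 : q < 2 ^ (n + 1))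
    (e₂ d : ℤ) (hgcd : IsCoprime ((p : ℤ) ^ 2 * q) e₂) (hd : e₂ * d ≡ 1 [ZMOD (p * q)])
    (m₁ m₂ k₁ k₂ : ℤ)
    (hm₁ : 2 ^ (3 * n) < m₁) (hm₁' : m₁ < 2 ^ (3 * n + 1))
    (hm₂ : 2 ^ (n - 2) < m₂) (hm₂' : m₂ < 2 ^ (n - 1))
    (hk₁ : 2 ^ (n - 1) < k₁) (hk₁' : k₁ < 2 ^ n)
    (hk₂ : 2 ^ (n - 1) < k₂) (hk₂' : k₂ < 2 ^ n)
    (U V C : ℤ)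
    (hU : U = m₁ * 2 ^ n + k₁) (hV : V = m₂ * 2 ^ n + k₂)
    (hC : C = U * ((p : ℤ) ^ 2 * q) + V ^ 2 * e₂) :
    (0 ≤ V ∧ V < 2 ^ (2 * n - 1) ∧ V ^ 2 ≡ C * d [ZMOD (p * q)] ∧
        ((p : ℤ) ^ 2 * q) ∣ (C - V ^ 2 * e₂)) ∧
    (∀ x : ℤ, 0 ≤ x → x < 2 ^ (2 * n - 1) → x ^ 2 ≡ C * d [ZMOD (p * q)] →
        ((p : ℤ) ^ 2 * q) ∣ (C - x ^ 2 * e₂) → x = V) ∧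
    U = (C - V ^ 2 * e₂) / ((p : ℤ) ^ 2 * q) ∧
    m₁ = U / 2 ^ n ∧ m₂ = V / 2 ^ n := by
  have hp0 : (0 : ℤ) < p := by exact_mod_cast hp.pos
  have hq0 : (0 : ℤ) < q := by exact_mod_cast hq.pos
  have hN : (0 : ℤ) < (p : ℤ) ^ 2 * q := by positivity
  have hb : (0 : ℤ) < 2 ^ n := by positivity
  have hb1 : (0 : ℤ) < 2 ^ (n - 1) := by positivity
  have hb2 : (0 : ℤ) < 2 ^ (n - 2) := by positivity
  have hpow : (2 : ℤ) ^ (2 * n - 1) = 2 ^ (n - 1) * 2 ^ n := by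
    rw [← pow_add]; congr 1; omega
  have hpow2 : (2 : ℤ) ^ n = 2 * 2 ^ (n - 1) := by
    rw [← pow_succ']; congr 1; omega
  have hV0 : 0 < V := by
    have := mul_pos (hb2.trans hm₂) hb
    linarith
  have hV1 : V < 2 ^ (2 * n - 1) := by
    rw [hpow]
    have : (m₂ + 1) * 2 ^ n ≤ 2 ^ (n - 1) * 2 ^ n :=
      mul_le_mul_of_nonneg_right (by linarith) hb.le
    linarith
  have hCV : C - V ^ 2 * e₂ = U * ((p : ℤ) ^ 2 * q) := by rw [hC]; ring
  refine ⟨⟨hV0.le, hV1, ?_, hCV ▸ dvd_mul_left _ _⟩, ?_, ?_, ?_, ?_⟩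
  · obtain ⟨t, ht⟩ := hd.symm.dvd
    refine (Int.modEq_iff_dvd).mpr ⟨U * p * d + V ^ 2 * t, ?_⟩
    rw [hC]
    linear_combination V ^ 2 * ht
  · intro x hx0 hx1 _ hx
    have hp1' : (2 : ℤ) ^ n < p := by exact_mod_cast hp1
    have hq1' : (2 : ℤ) ^ n < q := by exact_mod_cast hq1
    have hsum : V + x < 2 ^ n * 2 ^ n := by
      rw [hpow] at hV1 hx1
      have : (2 : ℤ) ^ n * 2 ^ n = 2 * (2 ^ (n - 1) * 2 ^ n) := by
        linear_combination 2 ^ n * hpow2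
      linarith
    have hdvd : (p : ℤ) ^ 2 * q ∣ V ^ 2 - x ^ 2 := by
      refine hgcd.dvd_of_dvd_mul_right ?_
      have : (V ^ 2 - x ^ 2) * e₂ = (C - x ^ 2 * e₂) - (C - V ^ 2 * e₂) := by ring
      rw [this]
      exact dvd_sub hx (hCV ▸ dvd_mul_left _ _)
    refine (eq_of_sq_mul_dvd_sq_sub_sq (Nat.prime_iff_prime_int.mp hp)
      (Nat.prime_iff_prime_int.mp hq)
      (Nat.isCoprime_iff_coprime.mpr ((Nat.coprime_primes hp hq).mpr hpq))
      hV0.le hx0 (by linarith) (hsum.trans ?_) (hsum.trans ?_) hdvd).symm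
    · rw [sq]
      exact mul_lt_mul'' hp1' hp1' hb.le hb.le
    · exact mul_lt_mul'' hp1' hq1' hb.le hb.le
  · rw [hCV, Int.mul_ediv_cancel _ hN.ne']
  · rw [hU]
    exact eq_mul_add_ediv (hb1.trans hk₁).le hk₁'
  · rw [hV]
    exact eq_mul_add_ediv (hb1.trans hk₂).le hk₂'
end

section
/- Let n ≥ 6 be an integer, let e₂ be an integer with 2^(3n+4) < e₂ < 2^(3n+6), and let a be any integer. Then the set of integers j such that 2^(4n) < a + e₂·j < 2^(4n+1) has cardinality at least 2^(n−6). In particular, exhaustively searching for the parameter j recovering U in the congruence attack on the AAβ ciphertext equation requires testing exponentially many candidates. -/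
/-- An open interval `(A, B)` with `m * e < B - A` contains at least `m` terms of any integer
arithmetic progression with common difference `e > 0`. -/
theorem le_ncard_arithProg_mem_Ioo {e A B : ℤ} (he : 0 < e) (m : ℕ) (hm : m * e < B - A) (a : ℤ) :
    m ≤ {j : ℤ | A < a + e * j ∧ a + e * j < B}.ncard := by
  have hlt : A - a < e * ((A - a) / e + 1) := by
    rw [mul_comm]; exact Int.lt_ediv_add_one_mul_self _ he
  have hle : e * ((A - a) / e) ≤ A - a := Int.mul_ediv_self_le he.ne'
  set q := (A - a) / e
  have hfin : {j : ℤ | A < a + e * j ∧ a + e * j < B}.Finite := by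
    refine (Set.finite_Icc q ((B - a) / e)).subset fun j hj => ⟨?_, ?_⟩
    · have : e * q < e * j := by linarith [hj.1]
      exact (lt_of_mul_lt_mul_left this he.le).le
    · rw [Int.le_ediv_iff_mul_le he]
      linarith [hj.2]
  have hsub : (Finset.Ioc q (q + m) : Set ℤ) ⊆ {j : ℤ | A < a + e * j ∧ a + e * j < B} := by
    intro j hj
    rw [Finset.coe_Ioc] at hj
    have hlo := mul_le_mul_of_nonneg_left (Int.add_one_le_of_lt hj.1) he.le
    have hhi := mul_le_mul_of_nonneg_left hj.2 he.le
    constructor <;> linarith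
  have hcard := Set.ncard_le_ncard hsub hfin
  rw [Set.ncard_coe_finset, Int.card_Ioc] at hcard
  simpa using hcard

/-- In the congruence attack on U, the number of candidate parameters j with
2^(4n) < a + e₂·j < 2^(4n+1) is at least 2^(n-6). -/
theorem stmt8 (n : ℕ) (hn : 6 ≤ n) (e₂ : ℤ)
    (h1 : 2 ^ (3 * n + 4) < e₂) (h2 : e₂ < 2 ^ (3 * n + 6)) (a : ℤ) :
    2 ^ (n - 6) ≤
      {j : ℤ | 2 ^ (4 * n) < a + e₂ * j ∧ a + e₂ * j < 2 ^ (4 * n + 1)}.ncard := by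
  have he : 0 < e₂ := lt_trans (by positivity) h1
  apply le_ncard_arithProg_mem_Ioo he
  have hpow : (2 : ℤ) ^ (n - 6) * 2 ^ (3 * n + 6) = 2 ^ (4 * n) := by
    rw [← pow_add]; congr 1; omega
  have hmul := mul_lt_mul_of_pos_left h2 (by positivity : (0 : ℤ) < 2 ^ (n - 6))
  push_cast
  rw [pow_succ]
  linarith
end

section
/- Let n ≥ 7 be an integer, let e₁ be an integer with 2^(3n) < e₁ < 2^(3n+3), and let b be any integer. Then the set of integers j such that 2^(4n−4) < b − e₁·j < 2^(4n−2) has cardinality at least 3·2^(n−7). In particular, exhaustively searching for the parameter j recovering V² in the congruence attack on the AAβ ciphertext equation requires testing exponentially many candidates. -/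
/-- If the length of the integer interval `(A, B)` exceeds `K * e`, then at least `K` integers `j`
satisfy `A < b - e * j < B`. -/
theorem le_ncard_sub_mul_mem_Ioo {e A B b : ℤ} {K : ℕ} (he : 0 < e) (hK : e * K < B - A) :
    K ≤ {j : ℤ | A < b - e * j ∧ b - e * j < B}.ncard := by
  have hfin : {j : ℤ | A < b - e * j ∧ b - e * j < B}.Finite := by
    refine (Set.finite_Ioo A B).preimage (f := fun j => b - e * j) fun x _ y _ hxy => ?_
    exact mul_left_cancel₀ he.ne' (sub_right_injective hxy)
  set q := (b - B) / e
  have hq : e * q ≤ b - B := Int.mul_ediv_self_le he.ne'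
  have hq' : b - B < e * (q + 1) := by
    linarith [Int.lt_mul_ediv_self_add (x := b - B) he]
  have hsub : Set.Ioc q (q + K) ⊆ {j : ℤ | A < b - e * j ∧ b - e * j < B} := by
    rintro j ⟨hj, hj'⟩
    have hlow : e * (q + 1) ≤ e * j := mul_le_mul_of_nonneg_left hj he.le
    have hupp : e * j ≤ e * (q + K) := mul_le_mul_of_nonneg_left hj' he.le
    rw [mul_add] at hupp
    constructor <;> linarith
  calc K = (Set.Ioc q (q + K)).ncard := by
        rw [← Finset.coe_Ioc, Set.ncard_coe_finset, Int.card_Ioc]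
        simp
    _ ≤ _ := Set.ncard_le_ncard hsub hfin

/-- In the congruence attack on V², the number of candidate parameters j with
2^(4n-4) < b − e₁·j < 2^(4n-2) is at least 3·2^(n-7). -/
theorem stmt9 (n : ℕ) (hn : 7 ≤ n) (e₁ : ℤ)
    (h1 : 2 ^ (3 * n) < e₁) (h2 : e₁ < 2 ^ (3 * n + 3)) (b : ℤ) :
    3 * 2 ^ (n - 7) ≤
      {j : ℤ | 2 ^ (4 * n - 4) < b - e₁ * j ∧ b - e₁ * j < 2 ^ (4 * n - 2)}.ncard := by
  refine le_ncard_sub_mul_mem_Ioo (lt_trans (by positivity) h1) ?_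
  have hpow : (2 : ℤ) ^ (4 * n - 4) = 2 ^ (3 * n + 3) * 2 ^ (n - 7) := by
    rw [← pow_add]
    congr 1
    omega
  have hpow' : (2 : ℤ) ^ (4 * n - 2) = 4 * 2 ^ (4 * n - 4) := by
    rw [show 4 * n - 2 = 4 * n - 4 + 2 by omega, pow_add]
    ring
  have hmul := mul_lt_mul_of_pos_right h2 (show (0 : ℤ) < 2 ^ (n - 7) by positivity)
  push_cast
  linarith
end
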